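/- Let 0 < α < β and suppose G ⊆ ℝ² satisfies hypothesis (ℋ). Then there exists a function r : ℝ² → ℝ which is continuously differentiable on ℝ², infinitely differentiable on ℝ² \ {(0,0)}, satisfies |r(λ, x)|/|x| → 0 as 0 ≠ |x| → 0 uniformly for λ in bounded intervals, and such that the set of non-trivial solutions of the equation λx = r(λ, x), i.e. {(λ, x) ∈ ℝ² : x ≠ 0 and λx = r(λ, x)}, is exactly G \ {(0,0)}. -/

import Mathlib

open Set

/-- The double cone C(α,β) = {(λ,x) : 0 < αλ < x < βλ or 0 > αλ > x > βλ} ∪ {(0,0)}. -/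
def cone (a b : ℝ) : Set (ℝ × ℝ) :=
  {p : ℝ × ℝ | (0 < a * p.1 ∧ a * p.1 < p.2 ∧ p.2 < b * p.1) ∨
    (a * p.1 < 0 ∧ p.2 < a * p.1 ∧ b * p.1 < p.2)} ∪ {((0 : ℝ), (0 : ℝ))}

/-- H⁺: the connected component of ℝ² \ G containing D⁺, the component of ℝ² \ C(α,β)
containing the positive λ-axis (represented by the point (1,0)). -/
def Hplus (G : Set (ℝ × ℝ)) : Set (ℝ × ℝ) :=
  connectedComponentIn Gᶜ ((1 : ℝ), (0 : ℝ))

/-- H⁻: the connected component of ℝ² \ G containing D⁻, the component of ℝ² \ C(α,β)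
containing the negative λ-axis (represented by the point (−1,0)). -/
def Hminus (G : Set (ℝ × ℝ)) : Set (ℝ × ℝ) :=
  connectedComponentIn Gᶜ ((-1 : ℝ), (0 : ℝ))

/-- Hypothesis (ℋ): G ⊆ C(α,β) is closed, connected, unbounded in both half-planes
{λ ≥ 0} and {λ ≤ 0}, and H⁺ ∩ H⁻ = ∅. -/
def hypH (a b : ℝ) (G : Set (ℝ × ℝ)) : Prop :=
  G ⊆ cone a b ∧ IsClosed G ∧ IsConnected G ∧
  ¬ Bornology.IsBounded (G ∩ {p : ℝ × ℝ | 0 ≤ p.1}) ∧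
  ¬ Bornology.IsBounded (G ∩ {p : ℝ × ℝ | p.1 ≤ 0}) ∧
  Hplus G ∩ Hminus G = ∅

/-- Multiplying by `x` a bounded continuous function of the slope `l / x` gives a function that is
continuous on the whole plane, including the axis `x = 0`. -/
lemma continuous_snd_mul_comp_div {a : ℝ → ℝ} (ha : Continuous a) (hc : HasCompactSupport a) :
    Continuous fun p : ℝ × ℝ => p.2 * a (p.1 / p.2) := by
  obtain ⟨K, hK⟩ := hc.exists_bound_of_continuous ha
  rw [continuous_iff_continuousAt]
  rintro ⟨l, x⟩
  by_cases hx : x = 0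
  · subst hx
    have h0 : Filter.Tendsto (fun p : ℝ × ℝ => |p.2| * K) (nhds (l, 0)) (nhds 0) := by
      have : Continuous fun p : ℝ × ℝ => |p.2| * K := by fun_prop
      simpa using this.tendsto (l, 0)
    have h1 : Filter.Tendsto (fun p : ℝ × ℝ => p.2 * a (p.1 / p.2)) (nhds (l, 0)) (nhds 0) := by
      refine squeeze_zero_norm (fun p => ?_) h0
      rw [norm_mul, Real.norm_eq_abs]
      exact mul_le_mul_of_nonneg_left (hK _) (abs_nonneg _)
    simpa [ContinuousAt] using h1
  · exact continuousAt_snd.mul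
      (ha.continuousAt.comp (continuousAt_fst.div continuousAt_snd hx))

lemma contDiff_one_snd_sq_mul_comp_div {k : ℝ → ℝ} (hk : ContDiff ℝ 1 k)
    (hc : HasCompactSupport k) :
    ContDiff ℝ 1 fun p : ℝ × ℝ => p.2 ^ 2 * k (p.1 / p.2) := by
  have hk' : Continuous (deriv k) := hk.continuous_deriv le_rfl
  have hA := continuous_snd_mul_comp_div hk' hc.deriv
  have hB := continuous_snd_mul_comp_div (a := fun u => 2 * k u - u * deriv k u)
    (by have := hk.continuous; fun_prop) (hc.mul_left.sub hc.deriv.mul_left)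
  rw [contDiff_one_iff_hasFDerivAt]
  refine ⟨fun p => (p.2 * deriv k (p.1 / p.2)) • ContinuousLinearMap.fst ℝ ℝ ℝ +
    (p.2 * (2 * k (p.1 / p.2) - p.1 / p.2 * deriv k (p.1 / p.2))) •
      ContinuousLinearMap.snd ℝ ℝ ℝ, by fun_prop, ?_⟩
  rintro ⟨l, x⟩
  by_cases hx : x = 0
  · subst hx
    obtain ⟨K, hK⟩ := hc.exists_bound_of_continuous hk.continuous
    have hO : (fun p : ℝ × ℝ => p.2 ^ 2 * k (p.1 / p.2)) =O[nhds (l, 0)]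
        fun p => ‖p - (l, 0)‖ ^ 2 := by
      refine Asymptotics.IsBigO.of_bound K (Filter.Eventually.of_forall fun p => ?_)
      have h1 : |p.2| ≤ ‖p - (l, 0)‖ := by
        simpa using norm_snd_le (p - (l, (0 : ℝ)))
      rw [norm_mul, norm_pow, norm_pow, norm_norm, mul_comm, Real.norm_eq_abs p.2]
      have hK0 : 0 ≤ K := (norm_nonneg _).trans (hK 0)
      gcongr
      exact hK _
    have := hO.hasFDerivAt (𝕜 := ℝ) (by norm_num)
    simpa using this
  · have hu : HasFDerivAt (fun p : ℝ × ℝ => p.1 / p.2)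
        (x⁻¹ • ContinuousLinearMap.fst ℝ ℝ ℝ + (-(l / x ^ 2)) • ContinuousLinearMap.snd ℝ ℝ ℝ)
        (l, x) := by
      have := (hasFDerivAt_fst (𝕜 := ℝ) (p := ((l, x) : ℝ × ℝ))).mul
        ((hasDerivAt_inv hx).comp_hasFDerivAt (l, x) (hasFDerivAt_snd (𝕜 := ℝ)))
      refine this.congr_fderiv ?_
      ext <;> simp
      field_simp
    have hkd : HasDerivAt k (deriv k (l / x)) (l / x) :=
      (hk.differentiable one_ne_zero _).hasDerivAt
    have := ((hasFDerivAt_snd (𝕜 := ℝ) (p := ((l, x) : ℝ × ℝ))).pow 2).mul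
      (hkd.comp_hasFDerivAt (l, x) hu)
    refine this.congr_fderiv ?_
    ext <;> simp <;> field_simp
    ring

lemma contDiffOn_snd_sq_mul_comp_div {n : WithTop ℕ∞} {k : ℝ → ℝ} (hk : ContDiff ℝ n k)
    (hc : HasCompactSupport k) :
    ContDiffOn ℝ n (fun p : ℝ × ℝ => p.2 ^ 2 * k (p.1 / p.2)) {((0 : ℝ), (0 : ℝ))}ᶜ := by
  rintro ⟨l, x⟩ hp
  refine ContDiffAt.contDiffWithinAt ?_
  by_cases hx : x = 0
  · subst hx
    have hl : l ≠ 0 := fun h => hp (by simp [h])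
    obtain ⟨R, hR⟩ := hc.isCompact.isBounded.exists_norm_le
    have hU : IsOpen {p : ℝ × ℝ | R * |p.2| < |p.1|} := isOpen_lt (by fun_prop) (by fun_prop)
    refine (contDiffAt_const (c := (0 : ℝ))).congr_of_eventuallyEq ?_
    filter_upwards [hU.mem_nhds (show R * |(0 : ℝ)| < |l| by simpa using hl)] with p hp
    by_cases h2 : p.2 = 0
    · simp [h2]
    · have : p.1 / p.2 ∉ tsupport k := fun h => by
        have := hR _ h
        rw [norm_div, Real.norm_eq_abs, Real.norm_eq_abs, div_le_iff₀ (abs_pos.2 h2)] at this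
        exact absurd hp (not_lt.2 this)
      simp [image_eq_zero_of_notMem_tsupport this]
  · exact (contDiffAt_snd.pow 2).mul
      (hk.contDiffAt.comp _ (contDiffAt_fst.div contDiffAt_snd hx))

lemma IsOpen.diff_connectedComponentIn {X : Type*} [TopologicalSpace X] [LocallyConnectedSpace X]
    {U : Set X} (hU : IsOpen U) (x : X) : IsOpen (U \ connectedComponentIn U x) := by
  rw [isOpen_iff_mem_nhds]
  rintro y ⟨hyU, hy⟩
  filter_upwards [hU.connectedComponentIn.mem_nhds (mem_connectedComponentIn hyU)] with z hz
  refine ⟨connectedComponentIn_subset _ _ hz, fun hzx => hy ?_⟩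
  rw [connectedComponentIn_eq hzx, ← connectedComponentIn_eq hz]
  exact mem_connectedComponentIn hyU

lemma abs_snd_of_mem_cone {a b : ℝ} {p : ℝ × ℝ} (hp : p ∈ cone a b) : a * |p.1| ≤ |p.2| := by
  rcases hp with (⟨h0, h1, -⟩ | ⟨h0, h1, -⟩) | rfl
  · calc a * |p.1| ≤ |a * p.1| := by rw [abs_mul]; gcongr; exact le_abs_self a
      _ ≤ |p.2| := abs_le_abs_of_nonneg h0.le h1.le
  · calc a * |p.1| ≤ |a * p.1| := by rw [abs_mul]; gcongr; exact le_abs_self a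
      _ ≤ |p.2| := abs_le_abs_of_nonpos h0.le h1.le
  · simp

lemma mem_Hplus {a b : ℝ} (ha : 0 < a) {G : Set (ℝ × ℝ)} (hG : G ⊆ cone a b) {p : ℝ × ℝ}
    (hp : |p.2| < a * p.1) : p ∈ Hplus G := by
  have hconv : Convex ℝ {q : ℝ × ℝ | |q.2| < a * q.1} := by
    have : {q : ℝ × ℝ | |q.2| < a * q.1} =
        {q | (a • LinearMap.fst ℝ ℝ ℝ - LinearMap.snd ℝ ℝ ℝ) q > 0} ∩
        {q | (a • LinearMap.fst ℝ ℝ ℝ + LinearMap.snd ℝ ℝ ℝ) q > 0} := by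
      ext q
      simp only [mem_ofPred_eq, abs_lt, mem_inter_iff, LinearMap.sub_apply, LinearMap.add_apply,
        LinearMap.smul_apply, LinearMap.fst_apply, LinearMap.snd_apply, smul_eq_mul]
      constructor <;> rintro ⟨h1, h2⟩ <;> constructor <;> linarith
    rw [this]
    exact (convex_halfSpace_gt (LinearMap.isLinear _) 0).inter
      (convex_halfSpace_gt (LinearMap.isLinear _) 0)
  refine hconv.isPreconnected.subset_connectedComponentIn (F := Gᶜ) (x := ((1 : ℝ), (0 : ℝ)))
    (by simpa using ha) ?_ hp
  intro q hq hqG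
  have := abs_snd_of_mem_cone (hG hqG)
  have h2 : a * q.1 ≤ a * |q.1| := by gcongr; exact le_abs_self _
  exact absurd hq (not_lt.2 (h2.trans this))

lemma mem_Hminus {a b : ℝ} (ha : 0 < a) {G : Set (ℝ × ℝ)} (hG : G ⊆ cone a b) {p : ℝ × ℝ}
    (hp : |p.2| < -(a * p.1)) : p ∈ Hminus G := by
  have hconv : Convex ℝ {q : ℝ × ℝ | |q.2| < -(a * q.1)} := by
    have : {q : ℝ × ℝ | |q.2| < -(a * q.1)} =
        {q | (a • LinearMap.fst ℝ ℝ ℝ - LinearMap.snd ℝ ℝ ℝ) q < 0} ∩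
        {q | (a • LinearMap.fst ℝ ℝ ℝ + LinearMap.snd ℝ ℝ ℝ) q < 0} := by
      ext q
      simp only [mem_ofPred_eq, abs_lt, mem_inter_iff, LinearMap.sub_apply, LinearMap.add_apply,
        LinearMap.smul_apply, LinearMap.fst_apply, LinearMap.snd_apply, smul_eq_mul]
      constructor <;> rintro ⟨h1, h2⟩ <;> constructor <;> linarith
    rw [this]
    exact (convex_halfSpace_lt (LinearMap.isLinear _) 0).inter
      (convex_halfSpace_lt (LinearMap.isLinear _) 0)
  refine hconv.isPreconnected.subset_connectedComponentIn (F := Gᶜ) (x := ((-1 : ℝ), (0 : ℝ)))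
    (by simpa using ha) ?_ hp
  intro q hq hqG
  have := abs_snd_of_mem_cone (hG hqG)
  have h2 : a * (-q.1) ≤ a * |q.1| := by gcongr; exact neg_le_abs _
  exact absurd hq (not_lt.2 ((neg_mul_eq_mul_neg a q.1).le.trans (h2.trans this)))

/-- A smooth bounded function vanishing exactly on `G`, positive on `H⁺` and negative on `H⁻`. -/
lemma exists_contDiff_sign {G : Set (ℝ × ℝ)} (hG : IsClosed G) (hH : Hplus G ∩ Hminus G = ∅) :
    ∃ η : ℝ × ℝ → ℝ, ContDiff ℝ (⊤ : ℕ∞) η ∧ (∀ p, |η p| ≤ 1) ∧ (∀ p, η p = 0 ↔ p ∈ G) ∧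
      (∀ p ∈ Hplus G, 0 < η p) ∧ ∀ p ∈ Hminus G, η p < 0 := by
  obtain ⟨f, hfs, hf, hf01⟩ :=
    (hG.isOpen_compl.diff_connectedComponentIn ((-1 : ℝ), (0 : ℝ))).exists_contDiff_support_eq
      (n := ⊤)
  obtain ⟨g, hgs, hg, hg01⟩ :=
    (hG.isOpen_compl.connectedComponentIn (x := ((-1 : ℝ), (0 : ℝ)))).exists_contDiff_support_eq
      (n := ⊤)
  have hf0 : ∀ p, 0 ≤ f p ∧ f p ≤ 1 := fun p => hf01 (mem_range_self p)
  have hg0 : ∀ p, 0 ≤ g p ∧ g p ≤ 1 := fun p => hg01 (mem_range_self p)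
  have hfp : ∀ p, f p ≠ 0 ↔ p ∉ G ∧ p ∉ Hminus G := fun p => by
    rw [← Function.mem_support, hfs]; rfl
  have hgp : ∀ p, g p ≠ 0 ↔ p ∈ Hminus G := fun p => by
    rw [← Function.mem_support, hgs]; rfl
  have hm : ∀ p ∈ Hminus G, p ∉ G := fun p hp => connectedComponentIn_subset _ _ hp
  have hneg : ∀ p ∈ Hminus G, f p - g p < 0 := fun p hp => by
    have h1 : f p = 0 := by by_contra h; exact ((hfp p).1 h).2 hp
    have h2 : 0 < g p := lt_of_le_of_ne (hg0 p).1 ((hgp p).2 hp).symm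
    linarith
  have hpos : ∀ p, p ∉ G → p ∉ Hminus G → 0 < f p - g p := fun p h h' => by
    have h1 : g p = 0 := by by_contra h; exact h' ((hgp p).1 h)
    have h2 : 0 < f p := lt_of_le_of_ne (hf0 p).1 ((hfp p).2 ⟨h, h'⟩).symm
    linarith
  refine ⟨fun p => f p - g p, hf.sub hg, fun p => ?_, fun p => ⟨fun h => ?_, fun h => ?_⟩,
    fun p hp => hpos p (connectedComponentIn_subset _ _ hp) fun hp' => ?_, hneg⟩
  · rw [abs_le]
    constructor <;> linarith [hf0 p, hg0 p]
  · by_contra hpG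
    by_cases h' : p ∈ Hminus G
    · exact (hneg p h').ne h
    · exact (hpos p hpG h').ne' h
  · have h1 : f p = 0 := by by_contra h'; exact ((hfp p).1 h').1 h
    have h2 : g p = 0 := by by_contra h'; exact hm p ((hgp p).1 h') h
    simp [h1, h2]
  · exact notMem_empty p (hH ▸ ⟨hp, hp'⟩)

/-- if G satisfies (ℋ) then there is r : ℝ² → ℝ, continuously differentiable
on ℝ², infinitely differentiable away from the origin, with |r(λ,x)|/|x| → 0 as 0 ≠ |x| → 0
uniformly for λ in bounded intervals, such that the set of non-trivial solutions of
λx = r(λ,x) is exactly G \ {(0,0)}. -/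
theorem stmt16 (α β : ℝ) (hαβ : 0 < α ∧ α < β) (G : Set (ℝ × ℝ)) (hG : hypH α β G) :
    ∃ r : ℝ × ℝ → ℝ,
      ContDiff ℝ 1 r ∧
      ContDiffOn ℝ (⊤ : ℕ∞) r ({((0 : ℝ), (0 : ℝ))}ᶜ) ∧
      (∀ C > (0 : ℝ), ∀ ε > (0 : ℝ), ∃ δ > (0 : ℝ), ∀ l x : ℝ, |l| ≤ C →
        x ≠ 0 → |x| < δ → |r (l, x)| ≤ ε * |x|) ∧
      {p : ℝ × ℝ | p.2 ≠ 0 ∧ p.1 * p.2 = r p} = G \ {((0 : ℝ), (0 : ℝ))} := by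
  obtain ⟨hα, -⟩ := hαβ
  obtain ⟨hGC, hGcl, -, -, -, hH⟩ := hG
  obtain ⟨η, hη, hη1, hη0, hηpos, hηneg⟩ := exists_contDiff_sign hGcl hH
  have hα' : 0 < α⁻¹ := inv_pos.2 hα
  let b : ContDiffBump (0 : ℝ) := ⟨α⁻¹, 2 * α⁻¹, hα', by linarith⟩
  let k : ℝ → ℝ := fun u => u * b u
  have hk : ∀ {n : ℕ∞}, ContDiff ℝ n k := contDiff_id.mul b.contDiff
  have hkc : HasCompactSupport k := b.hasCompactSupport.mul_left
  have hkx : ∀ l x : ℝ, x ≠ 0 → x ^ 2 * k (l / x) = x * (l * b (l / x)) := fun l x hx => by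
    simp only [k]; field_simp
  obtain ⟨K, hK⟩ := hkc.exists_bound_of_continuous (hk (n := 1)).continuous
  have hK0 : 0 ≤ K := (norm_nonneg _).trans (hK 0)
  refine ⟨fun p => p.2 ^ 2 * k (p.1 / p.2) - p.2 ^ 3 * η p, ?_, ?_, ?_, ?_⟩
  · exact (contDiff_one_snd_sq_mul_comp_div hk hkc).sub
      ((contDiff_snd.pow 3).mul (hη.of_le (by exact_mod_cast le_top)))
  · exact (contDiffOn_snd_sq_mul_comp_div hk hkc).sub ((contDiff_snd.pow 3).mul hη).contDiffOn
  · intro C _ ε hε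
    refine ⟨min 1 (ε / (K + 1)), by positivity, fun l x _ _ hxδ => ?_⟩
    have hx1 : |x| ≤ 1 := (hxδ.trans_le (min_le_left _ _)).le
    have hxε : |x| * (K + 1) ≤ ε :=
      (le_div_iff₀ (by positivity)).1 (hxδ.trans_le (min_le_right _ _)).le
    calc |x ^ 2 * k (l / x) - x ^ 3 * η (l, x)|
        ≤ |x| ^ 2 * |k (l / x)| + |x| ^ 3 * |η (l, x)| := by
          rw [← abs_pow, ← abs_pow, ← abs_mul, ← abs_mul]
          exact abs_sub _ _
      _ ≤ |x| ^ 2 * K + |x| ^ 2 * 1 := by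
          have hx32 : |x| ^ 3 ≤ |x| ^ 2 := pow_le_pow_of_le_one (abs_nonneg x) hx1 (by norm_num)
          exact add_le_add (mul_le_mul_of_nonneg_left (hK _) (by positivity))
            (mul_le_mul hx32 (hη1 _) (abs_nonneg _) (by positivity))
      _ = (|x| * (K + 1)) * |x| := by ring
      _ ≤ ε * |x| := by gcongr
  · ext ⟨l, x⟩
    simp only [mem_ofPred_eq, mem_sdiff, mem_singleton_iff]
    have hb : ∀ x ≠ 0, α * |l| ≤ |x| → b (l / x) = 1 := fun x hx h => by
      apply b.one_of_mem_closedBall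
      rw [mem_closedBall_zero_iff, norm_div, Real.norm_eq_abs, Real.norm_eq_abs,
        div_le_iff₀ (abs_pos.2 hx)]
      change |l| ≤ α⁻¹ * |x|
      rwa [inv_mul_eq_div, le_div_iff₀ hα, mul_comm]
    constructor
    · rintro ⟨hx, h⟩
      refine ⟨?_, by simp [hx]⟩
      have hx2 : 0 < x ^ 2 := by positivity
      have h : l * (1 - b (l / x)) + x ^ 2 * η (l, x) = 0 := by
        rw [hkx l x hx] at h
        apply mul_left_cancel₀ hx
        linear_combination h
      have hb1 : 0 ≤ 1 - b (l / x) := sub_nonneg.2 b.le_one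
      rw [← hη0]
      by_cases hc : α * |l| ≤ |x|
      · rw [hb x hx hc] at h
        simpa [hx] using h
      · exfalso
        push Not at hc
        rcases le_total 0 l with hl | hl
        · rw [abs_of_nonneg hl] at hc
          have h1 := mul_pos hx2 (hηpos _ (mem_Hplus hα hGC (p := (l, x)) hc))
          have h2 := mul_nonneg hl hb1
          linarith
        · rw [abs_of_nonpos hl] at hc
          have h1 := mul_neg_of_pos_of_neg hx2
            (hηneg _ (mem_Hminus hα hGC (p := (l, x)) (by simpa using hc)))
          have h2 := mul_nonpos_of_nonpos_of_nonneg hl hb1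
          linarith
    · rintro ⟨hp, h0⟩
      have hc : α * |l| ≤ |x| := abs_snd_of_mem_cone (hGC hp)
      have hx : x ≠ 0 := by
        rintro rfl
        have : |l| ≤ 0 := by
          rw [abs_zero] at hc
          exact nonpos_of_mul_nonpos_right hc hα
        exact h0 (by simp [abs_nonpos_iff.1 this])
      refine ⟨hx, ?_⟩
      rw [hkx l x hx, hb x hx hc, (hη0 _).2 hp]
      ring
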